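/- Let 𝒯 be a finite undirected tree and w : V(𝒯) → ℝ≥0 a weight function, and let (𝒯′, w′) be obtained from (𝒯, w) by contracting an edge {u,v} into a new vertex s (so N_{𝒯′}(s) = (N_𝒯(u) ∪ N_𝒯(v)) \ {u,v}, w′(s) = w(u) + w(v), and w′(x) = w(x) for all other x). Then: s is a centroid of (𝒯′,w′) if and only if u or v is a centroid of (𝒯,w); and for every x ∈ V(𝒯′) \ {s}, x is a centroid of (𝒯′,w′) if and only if x is a centroid of (𝒯,w). -/

import Mathlib

open Filter Topology

universe u

variable {V : Type u}

/-- Rooted trees with vertices labelled by elements of `V`. -/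
inductive RTree (V : Type u) : Type u where
  | node : V → List (RTree V) → RTree V

namespace RTree

/-- The root of a rooted tree. -/
def root : RTree V → V
  | node r _ => r

/-- The subtrees rooted at the children of the root. -/
def children : RTree V → List (RTree V)
  | node _ ts => ts

/-- The list of pairs `(v, path from the root to v)` over all vertices `v` of the tree. -/
def pathsFrom : RTree V → List (V × List V)
  | node r ts =>
      (r, [r]) ::
        (ts.attach.map fun t => (t.1.pathsFrom.map fun p => (p.1, r :: p.2))).flatten
  decreasing_by
    simp only [RTree.node.sizeOf_spec]
    have := List.sizeOf_lt_of_mem t.2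
    omega

/-- The vertex set of a rooted tree. -/
def vertSet (T : RTree V) : Set V := {v | ∃ p ∈ T.pathsFrom, p.1 = v}

/-- `Path_T(v)`: the set of vertices on the path in `T` from the root to `v`
(including both endpoints). -/
def pathSet (T : RTree V) (v : V) : Set V := {x | ∃ p ∈ T.pathsFrom, p.1 = v ∧ x ∈ p.2}

/-- The depth of a vertex `v` in `T`; the root has depth 1. -/
noncomputable def depth (T : RTree V) (v : V) : ℕ := (T.pathSet v).ncard

/-- All subtrees of a rooted tree (including the tree itself). -/
def allSubtrees : RTree V → List (RTree V)
  | node r ts => node r ts :: (ts.attach.map fun t => t.1.allSubtrees).flatten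
  decreasing_by
    simp only [RTree.node.sizeOf_spec]
    have := List.sizeOf_lt_of_mem t.2
    omega

/-- Two rooted trees are equivalent (represent the same search tree) if they have
the same root-to-vertex paths. -/
def Equiv (T₁ T₂ : RTree V) : Prop := ∀ v, T₁.pathSet v = T₂.pathSet v

end RTree

/-- `x` and `y` are joined by a walk of `G` staying inside `s`. -/
def ReachIn (G : SimpleGraph V) (s : Set V) (x y : V) : Prop :=
  ∃ p : G.Walk x y, ∀ v ∈ p.support, v ∈ s

/-- The connected component of `x` in the subgraph of `G` induced by `s`. -/
def compIn (G : SimpleGraph V) (s : Set V) (x : V) : Set V := {y | ReachIn G s x y}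

/-- The set of connected components of the subgraph of `G` induced by `s`. -/
def comps (G : SimpleGraph V) (s : Set V) : Set (Set V) := {c | ∃ x ∈ s, c = compIn G s x}

/-- `s` induces a (nonempty) connected subgraph of `G`. -/
def ConnIn (G : SimpleGraph V) (s : Set V) : Prop :=
  s.Nonempty ∧ ∀ x ∈ s, ∀ y ∈ s, ReachIn G s x y

/-- The total weight of a set of vertices. -/
noncomputable def wsum (w : V → ℝ) (s : Set V) : ℝ := ∑ᶠ x ∈ s, w x

/-- `IsSearchTree G s T`: `T` is a search tree on the subgraph of `G` induced by `s`.
Its root `r` is a vertex of `s`, its vertex set is `s`, and the subtrees rooted at the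
children of `r` are search trees on the connected components of the induced subgraph
on `s \ {r}` (one subtree for each component). -/
inductive IsSearchTree (G : SimpleGraph V) : Set V → RTree V → Prop where
  | node {s : Set V} {r : V} {ts : List (RTree V)} :
      r ∈ s →
      (RTree.node r ts).vertSet = s →
      (∀ t ∈ ts, IsSearchTree G (compIn G (s \ {r}) t.root) t) →
      ts.Pairwise (fun t₁ t₂ => compIn G (s \ {r}) t₁.root ≠ compIn G (s \ {r}) t₂.root) →
      IsSearchTree G s (RTree.node r ts)

/-- The cost of a search tree: `∑_x w(x) · depth(x)`, the root having depth 1. -/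
noncomputable def cost (w : V → ℝ) (T : RTree V) : ℝ :=
  ∑ᶠ v ∈ T.vertSet, w v * (T.depth v : ℝ)

/-- The optimum cost of a search tree on the subgraph of `G` induced by `s`. -/
noncomputable def OPT (G : SimpleGraph V) (w : V → ℝ) (s : Set V) : ℝ :=
  sInf (cost w '' {T | IsSearchTree G s T})

/-- `v` is an `α`-centroid of the subgraph of `G` induced by `s` (with weights `w`):
every connected component of the induced subgraph on `s \ {v}` has weight at most
`α` times the weight of `s`. -/
def IsAlphaCentroid (G : SimpleGraph V) (w : V → ℝ) (α : ℝ) (s : Set V) (v : V) : Prop :=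
  v ∈ s ∧ ∀ x ∈ s \ {v}, wsum w (compIn G (s \ {v}) x) ≤ α * wsum w s

/-- `v` is a centroid of the subgraph of `G` induced by `s` (with weights `w`). -/
def IsCentroid (G : SimpleGraph V) (w : V → ℝ) (s : Set V) (v : V) : Prop :=
  v ∈ s ∧ ∀ x ∈ s \ {v}, wsum w (compIn G (s \ {v}) x) ≤ wsum w s / 2

/-- `T` is an `α`-centroid tree on the subgraph of `G` induced by `s`. -/
def IsAlphaCentroidTree (G : SimpleGraph V) (w : V → ℝ) (α : ℝ) (s : Set V) (T : RTree V) :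
    Prop :=
  IsSearchTree G s T ∧ ∀ t ∈ T.allSubtrees, IsAlphaCentroid G w α t.vertSet t.root

/-- `T` is a centroid tree on the subgraph of `G` induced by `s`. -/
def IsCentroidTree (G : SimpleGraph V) (w : V → ℝ) (s : Set V) (T : RTree V) : Prop :=
  IsSearchTree G s T ∧ ∀ t ∈ T.allSubtrees, IsCentroid G w t.vertSet t.root

/-- `cent(𝒯,w)`: the maximum cost of a centroid tree. -/
noncomputable def centCost (G : SimpleGraph V) (w : V → ℝ) (s : Set V) : ℝ :=
  sSup (cost w '' {T | IsCentroidTree G w s T})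

/-- `centᵅ(𝒯,w)`: the maximum cost of an `α`-centroid tree (`0` if none exists, since
`sSup ∅ = 0` in `ℝ`). -/
noncomputable def centCostA (G : SimpleGraph V) (w : V → ℝ) (α : ℝ) (s : Set V) : ℝ :=
  sSup (cost w '' {T | IsAlphaCentroidTree G w α s T})

/-- `b` is a child of `a` in the rooted tree `T`. -/
def ChildRel (T : RTree V) (a b : V) : Prop :=
  ∃ t ∈ T.allSubtrees, t.root = a ∧ ∃ t' ∈ t.children, t'.root = b

namespace ReachIn

variable {G : SimpleGraph V} {s t : Set V} {x y z : V}

lemma refl (hx : x ∈ s) : ReachIn G s x x :=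
  ⟨SimpleGraph.Walk.nil, by simpa using hx⟩

lemma symm (h : ReachIn G s x y) : ReachIn G s y x := by
  obtain ⟨p, hp⟩ := h
  exact ⟨p.reverse, by simpa using hp⟩

lemma trans (hxy : ReachIn G s x y) (hyz : ReachIn G s y z) : ReachIn G s x z := by
  obtain ⟨p, hp⟩ := hxy
  obtain ⟨q, hq⟩ := hyz
  refine ⟨p.append q, fun a ha => ?_⟩
  rcases (SimpleGraph.Walk.mem_support_append_iff _ _).mp ha with h | h
  exacts [hp a h, hq a h]

lemma of_adj (hx : x ∈ s) (hy : y ∈ s) (h : G.Adj x y) : ReachIn G s x y :=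
  ⟨h.toWalk, by simp [hx, hy]⟩

lemma mono (hst : s ⊆ t) (h : ReachIn G s x y) : ReachIn G t x y := by
  obtain ⟨p, hp⟩ := h
  exact ⟨p, fun a ha => hst (hp a ha)⟩

/-- Walks inside `s` can be transported along any map sending adjacent vertices of `s` to
vertices that are joined inside `t`. -/
lemma map {V' : Type*} {G' : SimpleGraph V'} {t : Set V'} (f : V → V')
    (hf : ∀ a ∈ s, f a ∈ t) (hadj : ∀ a ∈ s, ∀ b ∈ s, G.Adj a b → ReachIn G' t (f a) (f b))
    (h : ReachIn G s x y) : ReachIn G' t (f x) (f y) := by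
  obtain ⟨p, hp⟩ := h
  induction p with
  | nil => exact refl (hf _ (hp _ (by simp)))
  | cons hab p ih =>
    simp only [SimpleGraph.Walk.support_cons, List.mem_cons, forall_eq_or_imp] at hp
    exact (hadj _ hp.1 _ (hp.2 _ p.start_mem_support) hab).trans (ih hp.2)

/-- A walk inside `s` either stays inside `s \ {z}` or `z` itself is reachable. -/
lemma diff_singleton_of_not (h : ReachIn G s x y) (hz : ¬ ReachIn G s x z) :
    ReachIn G (s \ {z}) x y := by
  classical
  obtain ⟨p, hp⟩ := h
  refine ⟨p, fun a ha => ⟨hp a ha, ?_⟩⟩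
  rintro rfl
  exact hz ⟨p.takeUntil a ha, fun b hb => hp b (p.support_takeUntil_subset_support ha hb)⟩

end ReachIn

lemma compIn_mono {G : SimpleGraph V} {s t : Set V} (hst : s ⊆ t) (x : V) :
    compIn G s x ⊆ compIn G t x :=
  fun _ h => h.mono hst

lemma compIn_eq_of_reachIn {G : SimpleGraph V} {s : Set V} {x y : V} (h : ReachIn G s x y) :
    compIn G s x = compIn G s y :=
  Set.ext fun _ => ⟨fun hz => h.symm.trans hz, fun hz => h.trans hz⟩

lemma wsum_mono [Finite V] {w : V → ℝ} (hw : ∀ x, 0 ≤ w x) {s t : Set V} (hst : s ⊆ t) :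
    wsum w s ≤ wsum w t := by
  have := Fintype.ofFinite V
  classical
  simp only [wsum, finsum_mem_eq_finite_toFinset_sum w (Set.toFinite _)]
  exact Finset.sum_le_sum_of_subset_of_nonneg (by simpa using hst) fun x _ _ => hw x

/-- Pushing weights forward along `f` turns the weight of a set into that of its preimage. -/
lemma wsum_eq_wsum_preimage [Finite V] {V' : Type*} [Finite V'] {w : V → ℝ} {w' : V' → ℝ}
    {f : V → V'} (h : ∀ y, w' y = wsum w (f ⁻¹' {y})) (s : Set V') :
    wsum w' s = wsum w (f ⁻¹' s) := by
  have hU : f ⁻¹' s = ⋃ y ∈ s, f ⁻¹' {y} := by ext; simp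
  rw [hU]
  unfold wsum at h ⊢
  rw [finsum_mem_biUnion _ s.toFinite fun _ _ => Set.toFinite _]
  · exact finsum_mem_congr rfl fun y _ => h y
  · intro a _ b _ hab
    exact Set.disjoint_left.2 fun x hx hx' => hab (hx.symm.trans hx')

/-- The two sides of an edge of an acyclic graph are disjoint. -/
lemma SimpleGraph.IsAcyclic.disjoint_compIn {G : SimpleGraph V} (hG : G.IsAcyclic) {u v : V}
    (huv : G.Adj u v) :
    Disjoint (compIn G (Set.univ \ {u}) v) (compIn G (Set.univ \ {v}) u) := by
  classical
  refine Set.disjoint_left.2 fun z hv hu => ?_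
  obtain ⟨p, hp⟩ := ReachIn.symm hv
  obtain ⟨q, hq⟩ := ReachIn.symm hu
  have hpu : u ∉ p.bypass.support := fun h => (hp u (p.support_bypass_subset_support h)).2 rfl
  have hqv : v ∉ q.bypass.support := fun h => (hq v (q.support_bypass_subset_support h)).2 rfl
  have hpath : (p.bypass.concat huv.symm).IsPath := p.bypass_isPath.concat hpu huv.symm
  have := (hG.subsingleton_path z u).elim ⟨_, hpath⟩ ⟨_, q.bypass_isPath⟩
  rw [Subtype.mk.injEq] at this
  rw [← this] at hqv
  simp [SimpleGraph.Walk.support_concat] at hqv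

/-- If the side of `v` across the edge `uv` is not too heavy, then centroids can be tested on the
components left after removing both `u` and `v`. -/
lemma isCentroid_of_compIn_le [Finite V] {G : SimpleGraph V} {w : V → ℝ} (hw : ∀ x, 0 ≤ w x)
    {u v : V} (hv : wsum w (compIn G (Set.univ \ {u}) v) ≤ wsum w Set.univ / 2)
    (h : ∀ x, x ≠ u → x ≠ v →
      wsum w (compIn G ((Set.univ \ {u}) \ {v}) x) ≤ wsum w Set.univ / 2) :
    IsCentroid G w Set.univ u := by
  refine ⟨Set.mem_univ u, fun x hx => ?_⟩
  by_cases hxv : ReachIn G (Set.univ \ {u}) x v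
  · rwa [compIn_eq_of_reachIn hxv]
  · have hne : x ≠ v := by
      rintro rfl
      exact hxv (ReachIn.refl hx)
    exact (wsum_mono hw fun _ hy => ReachIn.diff_singleton_of_not hy hxv).trans (h x hx.2 hne)

/-- Across an edge of a weighted forest, `u` or `v` is a centroid as soon as no component of
the graph without `u` and `v` is too heavy. -/
lemma isCentroid_or_isCentroid_iff [Finite V] {G : SimpleGraph V} (hG : G.IsAcyclic)
    {w : V → ℝ} (hw : ∀ x, 0 ≤ w x) {u v : V} (huv : G.Adj u v) :
    (IsCentroid G w Set.univ u ∨ IsCentroid G w Set.univ v) ↔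
      ∀ x, x ≠ u → x ≠ v →
        wsum w (compIn G ((Set.univ \ {u}) \ {v}) x) ≤ wsum w Set.univ / 2 := by
  constructor
  · rintro (h | h) x hxu hxv
    · exact (wsum_mono hw (compIn_mono Set.sdiff_subset x)).trans (h.2 x ⟨trivial, hxu⟩)
    · refine (wsum_mono hw (compIn_mono ?_ x)).trans (h.2 x ⟨trivial, hxv⟩)
      exact Set.sdiff_subset_sdiff_left Set.sdiff_subset
  · intro h
    have hsum : wsum w (compIn G (Set.univ \ {u}) v) + wsum w (compIn G (Set.univ \ {v}) u) ≤
        wsum w Set.univ := by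
      unfold wsum
      rw [← finsum_mem_union (hG.disjoint_compIn huv) (Set.toFinite _) (Set.toFinite _)]
      exact wsum_mono hw (Set.subset_univ _)
    rcases le_total (wsum w (compIn G (Set.univ \ {u}) v))
      (wsum w (compIn G (Set.univ \ {v}) u)) with hle | hle
    · exact Or.inl (isCentroid_of_compIn_le hw (by linarith) h)
    · refine Or.inr (isCentroid_of_compIn_le hw (v := u) (by linarith) fun x hxv hxu => ?_)
      rw [Set.sdiff_sdiff_comm]
      exact h x hxu hxv

/-- The map contracting the vertex `v` into the vertex `u`. -/
noncomputable def contractTo {u v : V} (huv : u ≠ v) (x : V) : {x : V // x ≠ v} :=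
  open Classical in if h : x = v then ⟨u, huv⟩ else ⟨x, h⟩

section contractTo

variable {u v : V} (huv : u ≠ v)

lemma contractTo_self : contractTo huv v = ⟨u, huv⟩ := dif_pos rfl

lemma contractTo_of_ne {x : V} (hx : x ≠ v) : contractTo huv x = ⟨x, hx⟩ := dif_neg hx

lemma contractTo_coe (x : {x : V // x ≠ v}) : contractTo huv x = x := contractTo_of_ne huv x.2

lemma contractTo_preimage_merged : contractTo huv ⁻¹' {⟨u, huv⟩} = {u, v} := by
  ext x
  by_cases hx : x = v
  · simp [hx, contractTo_self]
  · simp [contractTo_of_ne huv hx, hx]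

lemma contractTo_preimage_of_ne {x : {x : V // x ≠ v}} (hx : (x : V) ≠ u) :
    contractTo huv ⁻¹' {x} = {(x : V)} := by
  ext y
  by_cases hy : y = v
  · subst hy
    simp [contractTo_self, Subtype.ext_iff, hx.symm, x.2.symm]
  · simp [contractTo_of_ne huv hy, Subtype.ext_iff]

end contractTo

/-- Components of a contraction pull back to components of the original graph. -/
lemma preimage_compIn {V' : Type*} {G : SimpleGraph V} {G' : SimpleGraph V'} {f : V → V'}
    {g : V' → V} (hfg : ∀ y, f (g y) = y)
    (hfiber : ∀ x, g (f x) = x ∨ G.Adj (g (f x)) x)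
    (hadj : ∀ a b, G.Adj a b → f a = f b ∨ G'.Adj (f a) (f b))
    (hlift : ∀ a b, G'.Adj a b → ∃ c d, f c = a ∧ f d = b ∧ G.Adj c d)
    {s : Set V'} {x : V} (hx : f x ∈ s) :
    f ⁻¹' compIn G' s (f x) = compIn G (f ⁻¹' s) x := by
  have hgf : ∀ z, f z ∈ s → ReachIn G (f ⁻¹' s) (g (f z)) z := by
    intro z hz
    have hz' : g (f z) ∈ f ⁻¹' s := by rwa [Set.mem_preimage, hfg]
    rcases hfiber z with h | h
    · rw [h]
      exact .refl hz
    · exact .of_adj hz' hz h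
  ext y
  constructor
  · intro h
    have hy : f y ∈ s := by
      obtain ⟨p, hp⟩ := h
      exact hp _ p.end_mem_support
    refine (hgf x hx).symm.trans (ReachIn.trans ?_ (hgf y hy))
    refine ReachIn.map g (fun a ha => by rwa [Set.mem_preimage, hfg]) ?_ h
    intro a ha b hb hab
    obtain ⟨c, d, rfl, rfl, hcd⟩ := hlift a b hab
    exact (hgf c ha).trans ((ReachIn.of_adj (s := f ⁻¹' s) ha hb hcd).trans (hgf d hb).symm)
  · refine ReachIn.map f (fun a ha => ha) fun a ha b hb hab => ?_
    rcases hadj a b hab with h | h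
    · rw [h]
      exact .refl hb
    · exact .of_adj ha hb h

theorem contraction_preserves_centroids {V : Type} [Fintype V]
    (G : SimpleGraph V) (hG : G.IsTree) (w : V → ℝ) (hw : ∀ x, 0 ≤ w x)
    (u v : V) (huv : G.Adj u v)
    (G' : SimpleGraph {x : V // x ≠ v})
    (hG'adj : ∀ a b : {x : V // x ≠ v}, a ≠ b →
      (G'.Adj a b ↔ (G.Adj (a : V) (b : V) ∨ ((a : V) = u ∧ G.Adj v (b : V)) ∨
        ((b : V) = u ∧ G.Adj (a : V) v))))
    (w' : {x : V // x ≠ v} → ℝ)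
    (hw's : w' ⟨u, huv.ne⟩ = w u + w v)
    (hw'x : ∀ x : {x : V // x ≠ v}, (x : V) ≠ u → w' x = w (x : V)) :
    (IsCentroid G' w' Set.univ ⟨u, huv.ne⟩ ↔
      (IsCentroid G w Set.univ u ∨ IsCentroid G w Set.univ v)) ∧
    (∀ x : {x : V // x ≠ v}, (x : V) ≠ u →
      (IsCentroid G' w' Set.univ x ↔ IsCentroid G w Set.univ (x : V))) := by
  classical
  set f := contractTo huv.ne with hf
  have hwf : ∀ y, w' y = wsum w (f ⁻¹' {y}) := by
    intro y
    by_cases hy : (y : V) = u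
    · obtain rfl : y = ⟨u, huv.ne⟩ := Subtype.ext hy
      rw [hf, contractTo_preimage_merged, hw's, wsum, finsum_mem_pair huv.ne]
    · rw [hf, contractTo_preimage_of_ne huv.ne hy, hw'x y hy, wsum, finsum_mem_singleton]
  have hws : ∀ s, wsum w' s = wsum w (f ⁻¹' s) := wsum_eq_wsum_preimage hwf
  have hcomp : ∀ (s : Set {x : V // x ≠ v}) (x : V), f x ∈ s →
      f ⁻¹' compIn G' s (f x) = compIn G (f ⁻¹' s) x := by
    intro s x hx
    refine preimage_compIn (g := Subtype.val) (contractTo_coe huv.ne) ?_ ?_ ?_ hx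
    · intro x
      by_cases h : x = v
      · subst h
        exact Or.inr (by simpa [hf, contractTo_self] using huv)
      · exact Or.inl (by simp [contractTo_of_ne huv.ne h])
    · intro a b hab
      refine or_iff_not_imp_left.2 fun hne => (hG'adj _ _ hne).2 ?_
      by_cases ha : a = v
      · subst ha
        have hb : b ≠ a := hab.ne'
        simpa [hf, contractTo_self, contractTo_of_ne huv.ne hb] using Or.inr (Or.inl hab)
      · by_cases hb : b = v
        · subst hb
          simpa [hf, contractTo_self, contractTo_of_ne huv.ne ha] using Or.inr (Or.inr hab)
        · simpa [hf, contractTo_of_ne huv.ne ha, contractTo_of_ne huv.ne hb] using Or.inl hab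
    · intro a b hab
      rcases (hG'adj a b hab.ne).1 hab with h | ⟨h, h'⟩ | ⟨h, h'⟩
      · exact ⟨a, b, contractTo_coe huv.ne a, contractTo_coe huv.ne b, h⟩
      · exact ⟨v, b, (contractTo_self huv.ne).trans (Subtype.ext h.symm),
          contractTo_coe huv.ne b, h'⟩
      · exact ⟨a, v, contractTo_coe huv.ne a,
          (contractTo_self huv.ne).trans (Subtype.ext h.symm), h'⟩
  have hsurj : Function.Surjective f := fun y => ⟨y, contractTo_coe huv.ne y⟩
  have key : ∀ r, IsCentroid G' w' Set.univ r ↔ ∀ x, x ∉ f ⁻¹' {r} →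
      wsum w (compIn G (Set.univ \ f ⁻¹' {r}) x) ≤ wsum w Set.univ / 2 := by
    intro r
    simp only [IsCentroid, Set.mem_univ, true_and, hsurj.forall, hws]
    refine forall_congr' fun x => ?_
    have hmem : f x ∈ Set.univ \ {r} ↔ x ∉ f ⁻¹' {r} := by simp
    rw [hmem]
    refine forall_congr' fun hx => ?_
    rw [hcomp _ _ (hmem.2 hx), Set.preimage_sdiff, Set.preimage_univ]
  refine ⟨?_, fun x hx => ?_⟩
  · rw [key, isCentroid_or_isCentroid_iff hG.2 hw huv, hf, contractTo_preimage_merged,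
      Set.sdiff_sdiff, Set.singleton_union]
    simp
  · rw [key, hf, contractTo_preimage_of_ne huv.ne hx]
    simp [IsCentroid]
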